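/- Let Γ ⊆ Iso(ℝⁿ_s) be a discrete subgroup acting freely and properly discontinuously on ℝⁿ whose centraliser in Iso(ℝⁿ_s) has an open orbit. Then every γ ∈ Γ has the form γ = (I + A, v) where A² = 0, Av = 0, im A is totally isotropic, v ∈ (im A)^⊥, im A = (ker A)^⊥ and ker A = (im A)^⊥. -/

import Mathlib

noncomputable section

/-- `ℝⁿ` as a coordinate space. -/
abbrev E (n : ℕ) : Type := Fin n → ℝ

/-- The standard symmetric bilinear form of signature `(n-s, s)` on `ℝⁿ`. -/
def B (n s : ℕ) : LinearMap.BilinForm ℝ (E n) :=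
  LinearMap.mk₂ ℝ
    (fun x y => ∑ i : Fin n, (if (i : ℕ) < n - s then x i * y i else -(x i * y i)))
    (by
      intro x x' y
      rw [← Finset.sum_add_distrib]
      refine Finset.sum_congr rfl fun i _ => ?_
      by_cases h : (i : ℕ) < n - s <;> simp [h] <;> ring)
    (by
      intro c x y
      rw [Finset.smul_sum]
      refine Finset.sum_congr rfl fun i _ => ?_
      by_cases h : (i : ℕ) < n - s <;> simp [h] <;> ring)
    (by
      intro x y y'
      rw [← Finset.sum_add_distrib]
      refine Finset.sum_congr rfl fun i _ => ?_
      by_cases h : (i : ℕ) < n - s <;> simp [h] <;> ring)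
    (by
      intro c x y
      rw [Finset.smul_sum]
      refine Finset.sum_congr rfl fun i _ => ?_
      by_cases h : (i : ℕ) < n - s <;> simp [h] <;> ring)

/-- Orthogonal complement (w.r.t. the form `B n s`) of a set `S ⊆ ℝⁿ`. -/
def perp (n s : ℕ) (S : Set (E n)) : Set (E n) :=
  {x | ∀ w ∈ S, B n s x w = 0}

/-- A set of vectors is totally isotropic if the form vanishes identically on it. -/
def TotallyIsotropicSet (n s : ℕ) (U : Set (E n)) : Prop :=
  ∀ u ∈ U, ∀ u' ∈ U, B n s u u' = 0

/-- The set `T(D)` of translations preserving `D`. -/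
def TransSet (n : ℕ) (D : Set (E n)) : Set (E n) :=
  {v | ∀ x ∈ D, v + x ∈ D}

/-- `D` is translationally isotropic if `T(D)^⊥ ⊆ T(D)`. -/
def TranslationallyIsotropic (n s : ℕ) (D : Set (E n)) : Prop :=
  perp n s (TransSet n D) ⊆ TransSet n D

/-- The group of invertible affine transformations of `ℝⁿ`. -/
abbrev Aff (n : ℕ) : Type := (E n) ≃ᵃ[ℝ] (E n)

/-- The affine isometries of `ℝⁿ_s`: affine transformations whose linear part
preserves the bilinear form. -/
def Iso (n s : ℕ) : Set (Aff n) :=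
  {g | ∀ x y : E n, B n s (g.linear x) (g.linear y) = B n s x y}

/-- For `γ = (I + A, v)`, the matrix `A`, i.e. the linear part minus the identity. -/
def linA (n : ℕ) (γ : Aff n) : (E n) →ₗ[ℝ] (E n) :=
  γ.linear.toLinearMap - LinearMap.id

/-- The translation part `v` of an affine transformation. -/
def transPart (n : ℕ) (γ : Aff n) : E n := γ 0

/-- The Wolf properties of a single affine isometry `γ = (I + A, v)`:
`A² = 0`, `Av = 0`, `im A` totally isotropic, `v ⊥ im A`,
`im A = (ker A)^⊥` and `ker A = (im A)^⊥`. -/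
def WolfElt (n s : ℕ) (γ : Aff n) : Prop :=
  linA n γ ∘ₗ linA n γ = 0 ∧
  linA n γ (transPart n γ) = 0 ∧
  TotallyIsotropicSet n s (LinearMap.range (linA n γ) : Set (E n)) ∧
  transPart n γ ∈ perp n s (LinearMap.range (linA n γ) : Set (E n)) ∧
  (LinearMap.range (linA n γ) : Set (E n)) = perp n s (LinearMap.ker (linA n γ) : Set (E n)) ∧
  (LinearMap.ker (linA n γ) : Set (E n)) = perp n s (LinearMap.range (linA n γ) : Set (E n))

/-- The linear holonomy group `Hol(Γ)` (the group of linear parts) is abelian. -/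
def HolAbelian (n : ℕ) (Γ : Subgroup (Aff n)) : Prop :=
  ∀ γ₁ ∈ Γ, ∀ γ₂ ∈ Γ,
    γ₁.linear.toLinearMap ∘ₗ γ₂.linear.toLinearMap =
      γ₂.linear.toLinearMap ∘ₗ γ₁.linear.toLinearMap

/-- The centraliser of `Γ` in `Iso(ℝⁿ_s)`. -/
def CentrIso (n s : ℕ) (Γ : Subgroup (Aff n)) : Set (Aff n) :=
  {g ∈ Iso n s | ∀ γ ∈ Γ, g * γ = γ * g}

/-- The subspace `U_Γ = ∑_{(I+A,v) ∈ Γ} im A`. -/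
def UGamma (n : ℕ) (Γ : Subgroup (Aff n)) : Submodule ℝ (E n) :=
  ⨆ γ ∈ Γ, LinearMap.range (linA n γ)

/-- The set `U₀ = U_Γ ∩ U_Γ^⊥`. -/
def U0 (n s : ℕ) (Γ : Subgroup (Aff n)) : Set (E n) :=
  (UGamma n Γ : Set (E n)) ∩ perp n s (UGamma n Γ : Set (E n))

/-- The translation `τ_u : x ↦ u + x` as an affine transformation. -/
def τ (n : ℕ) (u : E n) : Aff n := AffineEquiv.constVAdd ℝ (E n) u


theorem B_apply (n s : ℕ) (x y : E n) : B n s x y =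
    ∑ i : Fin n, (if (i : ℕ) < n - s then x i * y i else -(x i * y i)) := rfl

theorem B_symm (n s : ℕ) (x y : E n) : B n s x y = B n s y x := by
  simp only [B_apply, mul_comm]

theorem B_nondeg (n s : ℕ) (x : E n) (h : ∀ y, B n s x y = 0) : x = 0 := by
  funext i
  have h1 := h (Pi.single i 1)
  rw [B_apply, Finset.sum_eq_single i] at h1
  · by_cases hi : (i : ℕ) < n - s <;> simpa [hi] using h1
  · intro j _ hj
    simp [Pi.single_eq_of_ne hj]
  · simp

theorem aff_apply (n : ℕ) (γ : Aff n) (x : E n) :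
    γ x = x + (linA n γ x + transPart n γ) := by
  have h := γ.map_vadd 0 x
  simp only [vadd_eq_add, add_zero] at h
  rw [h]
  simp only [linA, transPart, LinearMap.sub_apply, LinearMap.id_apply, LinearEquiv.coe_coe]
  abel

theorem aff_sub (n : ℕ) (γ : Aff n) (x y : E n) : γ.linear (x - y) = γ x - γ y := by
  have h := γ.toAffineMap.linearMap_vsub x y
  simpa using h

/-- **Wolf.** If `Γ ⊆ Iso(ℝⁿ_s)` is a discrete subgroup acting freely and
properly discontinuously on `ℝⁿ` whose centraliser in `Iso(ℝⁿ_s)` has an open orbit,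
then every `γ ∈ Γ` has the Wolf form `(I + A, v)` with `A² = 0`, `Av = 0`, `im A`
totally isotropic, `v ⊥ im A`, `im A = (ker A)^⊥` and `ker A = (im A)^⊥`. -/
theorem wolf_properties_of_homogeneous_holonomy
    (n s : ℕ) (hn : 1 ≤ n) (hs : s ≤ n)
    (Γ : Subgroup (Aff n)) (hΓIso : (Γ : Set (Aff n)) ⊆ Iso n s)
    (hdiscrete : DiscreteTopology
      ((fun γ : Aff n => (LinearMap.toMatrix' γ.linear.toLinearMap, γ 0)) ''
        (Γ : Set (Aff n))))
    (hfree : ∀ γ ∈ Γ, ∀ x : E n, γ x = x → γ = 1)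
    (hproper : ∀ K : Set (E n), IsCompact K →
      {γ : Aff n | γ ∈ Γ ∧ ((fun x => γ x) '' K ∩ K).Nonempty}.Finite)
    (hopenorbit : ∃ p : E n, IsOpen ((fun g => g p) '' CentrIso n s Γ)) :
    ∀ γ ∈ Γ, WolfElt n s γ := by
  intro γ hγ
  obtain ⟨p, hp⟩ := hopenorbit
  set A := linA n γ with hA
  set v := transPart n γ with hv
  have hγA : ∀ x, γ x - x = A x + v := by
    intro x
    rw [aff_apply n γ x]
    simp [hA, hv]
  have hconst : ∀ q ∈ (fun g : Aff n => g p) '' CentrIso n s Γ,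
      B n s (A q + v) (A q + v) = B n s (A p + v) (A p + v) := by
    rintro q ⟨g, ⟨hg, hc⟩, rfl⟩
    have h1 : γ (g p) = g (γ p) := by
      have := congrArg (fun k : Aff n => k p) (hc γ hγ)
      exact this.symm
    have h2 : A (g p) + v = g.linear (A p + v) := by
      rw [← hγA, ← hγA, aff_sub, h1]
    show B n s (A (g p) + v) (A (g p) + v) = _
    rw [h2, hg]
  have hpO : p ∈ (fun g : Aff n => g p) '' CentrIso n s Γ := by
    refine ⟨1, ⟨?_, ?_⟩, rfl⟩
    · intro x y
      rfl
    · intro δ _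
      simp
  have hkey : ∀ x, B n s (A x) (A x) = 0 ∧ B n s (A p + v) (A x) = 0 := by
    intro x
    have hcont : Continuous (fun t : ℝ => p + t • x) := by fun_prop
    have ho := hp.preimage hcont
    obtain ⟨ε, hε, hball⟩ := Metric.isOpen_iff.1 ho 0 (by simpa using hpO)
    have hex : ∀ t : ℝ, |t| < ε →
        2 * t * B n s (A p + v) (A x) + t * t * B n s (A x) (A x) = 0 := by
      intro t ht
      have h := hconst (p + t • x) (hball (by simpa using ht))
      have e : A (p + t • x) + v = (A p + v) + t • A x := by
        rw [map_add, map_smul]; abel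
      rw [e] at h
      generalize A p + v = w at h ⊢
      simp only [map_add, LinearMap.add_apply, map_smul, LinearMap.smul_apply, smul_eq_mul,
        B_symm n s (A x) w] at h
      linarith
    have h1 := hex (ε / 2) (by rw [abs_of_pos] <;> linarith)
    have h2 := hex (-(ε / 2)) (by rw [abs_neg, abs_of_pos] <;> linarith)
    constructor
    · have : (ε * ε) * B n s (A x) (A x) = 0 := by linarith
      exact (mul_eq_zero.1 this).resolve_left (by positivity)
    · have : ε * B n s (A p + v) (A x) = 0 := by linarith
      exact (mul_eq_zero.1 this).resolve_left (by positivity)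
  have hiso : ∀ x y, B n s (A x) (A y) = 0 := by
    intro x y
    have h := (hkey (x + y)).1
    simp only [map_add, LinearMap.add_apply, (hkey x).1, (hkey y).1,
      B_symm n s (A y) (A x)] at h
    linarith
  have hvA : ∀ x, B n s v (A x) = 0 := by
    intro x
    have h := (hkey x).2
    rw [map_add, LinearMap.add_apply, hiso] at h
    linarith
  have hskew : ∀ x y, B n s (A x) y = - B n s x (A y) := by
    intro x y
    have h := hΓIso hγ x y
    have e : ∀ z, γ.linear z = z + A z := by
      intro z
      simp [hA, linA]
    rw [e, e] at h
    simp only [map_add, LinearMap.add_apply, hiso] at h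
    linarith
  have hker : (LinearMap.ker A : Set (E n)) = perp n s (LinearMap.range A : Set (E n)) := by
    ext x
    simp only [SetLike.mem_coe, LinearMap.mem_ker, perp, Set.mem_ofPred_eq]
    constructor
    · rintro hx _ ⟨y, rfl⟩
      have := hskew x y
      rw [hx, map_zero, LinearMap.zero_apply] at this
      linarith
    · intro hx
      apply B_nondeg n s
      intro y
      rw [hskew, hx _ ⟨y, rfl⟩, neg_zero]
  have hrefl : (B n s).IsRefl := by
    intro x y h
    rw [B_symm, h]
  have hnd : (B n s).Nondegenerate :=
    ⟨fun x h => B_nondeg n s x h, fun x h => B_nondeg n s x fun y => by rw [B_symm, h]⟩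
  have hperp : ∀ W : Submodule ℝ (E n), perp n s (W : Set (E n)) = ((B n s).orthogonal W : Set (E n)) := by
    intro W
    ext x
    simp only [perp, Set.mem_ofPred_eq, SetLike.mem_coe, LinearMap.BilinForm.mem_orthogonal_iff]
    exact forall₂_congr fun w _ => by rw [B_symm]
  refine ⟨?_, ?_, ?_, ?_, ?_, hker⟩
  · refine LinearMap.ext fun x => ?_
    apply B_nondeg n s
    intro y
    rw [LinearMap.comp_apply, hskew, hiso, neg_zero]
  · apply B_nondeg n s
    intro y
    rw [hskew, hvA, neg_zero]
  · rintro _ ⟨x, rfl⟩ _ ⟨y, rfl⟩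
    exact hiso x y
  · rintro _ ⟨x, rfl⟩
    exact hvA x
  · have h1 : LinearMap.ker A = (B n s).orthogonal (LinearMap.range A) := by
      apply SetLike.coe_injective
      rw [hker, hperp]
    show (LinearMap.range A : Set (E n)) = perp n s (LinearMap.ker A : Set (E n))
    rw [hperp, h1, LinearMap.BilinForm.orthogonal_orthogonal hnd hrefl]

end
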